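/- For every n ∈ 16ℕ with n ≥ 32 and every j ∈ ℕ(n), Δ_j f_n = Δ_j h. Moreover, there exist constants c, C > 0 independent of n such that for all sufficiently large n ∈ 16ℕ, c·n ≤ Σ_{j∈ℕ(n)} ‖Δ_j f_n‖_{L^∞(𝕋)} ≤ C·n. -/

import Mathlib

open MeasureTheory Filter Function
open scoped ENNReal NNReal

noncomputable section

/-- The Fourier coefficient `û(ξ) = ∫_{-π}^{π} e^{-i x ξ} u(x) dx` of a `2π`-periodic
function on the torus. -/
def fCoeff (u : ℝ → ℂ) (ξ : ℤ) : ℂ :=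
  ∫ x in (-Real.pi)..Real.pi, Complex.exp (-Complex.I * x * ξ) * u x

/-- A Littlewood–Paley cutoff function: smooth, even, `0 ≤ χ ≤ 1`, `χ = 1` on `[-3/4,3/4]`,
`supp χ ⊆ (-4/3, 4/3)`, nonincreasing on `[0,∞)`. -/
structure LPCutoff where
  χ : ℝ → ℝ
  smooth : ContDiff ℝ (⊤ : ℕ∞) χ
  even : ∀ x, χ (-x) = χ x
  nonneg : ∀ x, 0 ≤ χ x
  le_one : ∀ x, χ x ≤ 1
  eq_one : ∀ x ∈ Set.Icc (-(3/4) : ℝ) (3/4 : ℝ), χ x = 1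
  supp : ∀ x, χ x ≠ 0 → x ∈ Set.Ioo (-(4/3) : ℝ) (4/3 : ℝ)
  decay : AntitoneOn χ (Set.Ici 0)

/-- `φ(ξ) = χ(ξ/2) - χ(ξ)`. -/
def LPCutoff.phi (c : LPCutoff) (x : ℝ) : ℝ := c.χ (x / 2) - c.χ x

/-- The dyadic block `Δ_j u` (for `j ≥ -1`). -/
def LPblock (c : LPCutoff) (j : ℤ) (u : ℝ → ℂ) (x : ℝ) : ℂ :=
  if j = -1 then
    (1 / (2 * Real.pi)) * ∑' ξ : ℤ, (c.χ ξ : ℂ) * fCoeff u ξ * Complex.exp (Complex.I * x * ξ)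
  else
    (1 / (2 * Real.pi)) *
      ∑' ξ : ℤ, (c.phi ((2:ℝ) ^ (-j) * ξ) : ℂ) * fCoeff u ξ * Complex.exp (Complex.I * x * ξ)

/-- The low-frequency cut-off `S_j u`. -/
def LPlow (c : LPCutoff) (j : ℤ) (u : ℝ → ℂ) (x : ℝ) : ℂ :=
  (1 / (2 * Real.pi)) *
    ∑' ξ : ℤ, (c.χ ((2:ℝ) ^ (-j) * ξ) : ℂ) * fCoeff u ξ * Complex.exp (Complex.I * x * ξ)

/-- The `L^∞(𝕋)` (sup) norm, with values in `ℝ≥0∞`. -/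
def supNormE {E : Type*} [NormedAddCommGroup E] (f : ℝ → E) : ℝ≥0∞ :=
  ⨆ x : ℝ, (‖f x‖₊ : ℝ≥0∞)

/-- View a real-valued function as a complex-valued one. -/
def toC (f : ℝ → ℝ) : ℝ → ℂ := fun x => (f x : ℂ)

/-- The `2π`-periodic square wave: `1/2` on `(0,π)`, `-1/2` on `(-π,0)`, `0` on `{-π,0,π}`. -/
def hFun (x : ℝ) : ℝ :=
  let y := x - 2 * Real.pi * ⌊(x + Real.pi) / (2 * Real.pi)⌋
  if y = 0 ∨ y = -Real.pi then 0 else if 0 < y then 1/2 else -1/2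

/-- The low-frequency part `f_n = S_{n/2} h` (real-valued). -/
def fLow (c : LPCutoff) (n : ℕ) : ℝ → ℝ := fun x => (LPlow c ((n : ℤ) / 2) (toC hFun) x).re

lemma neg_one_zpow_or (ξ : ℤ) : (-1 : ℝ) ^ ξ = 1 ∨ (-1 : ℝ) ^ ξ = -1 := by
  rcases Int.even_or_odd ξ with h | h
  · exact Or.inl h.neg_one_zpow
  · exact Or.inr h.neg_one_zpow

def H (ξ : ℤ) : ℝ := (1 - (-1 : ℝ) ^ ξ) / ξ

lemma hFun_pos {x : ℝ} (hx : x ∈ Set.Ioo 0 Real.pi) : hFun x = 1 / 2 := by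
  have hp := Real.pi_pos
  have hf : ⌊(x + Real.pi) / (2 * Real.pi)⌋ = 0 := by
    rw [Int.floor_eq_zero_iff]
    constructor
    · have := hx.1; positivity
    · rw [div_lt_one (by positivity)]; linarith [hx.2]
  have h1 : ¬ (x = 0 ∨ x = -Real.pi) := by
    rintro (h | h) <;> linarith [hx.1]
  simp only [hFun, hf, Int.cast_zero, mul_zero, sub_zero, if_neg h1, if_pos hx.1]

lemma hFun_neg {x : ℝ} (hx : x ∈ Set.Ioo (-Real.pi) 0) : hFun x = -1 / 2 := by
  have hp := Real.pi_pos
  have hf : ⌊(x + Real.pi) / (2 * Real.pi)⌋ = 0 := by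
    rw [Int.floor_eq_zero_iff]
    constructor
    · have : 0 < x + Real.pi := by linarith [hx.1]
      positivity
    · rw [div_lt_one (by positivity)]; linarith [hx.2]
  have h1 : ¬ (x = 0 ∨ x = -Real.pi) := by
    rintro (h | h) <;> linarith [hx.1, hx.2]
  simp only [hFun, hf, Int.cast_zero, mul_zero, sub_zero, if_neg h1, if_neg (not_lt.2 hx.2.le)]

lemma ii_congr {a b : ℝ} (hab : a ≤ b) {f g : ℝ → ℂ} (h : ∀ x ∈ Set.Ioo a b, f x = g x) :
    ∫ x in a..b, f x = ∫ x in a..b, g x := by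
  rw [intervalIntegral.integral_of_le hab, intervalIntegral.integral_of_le hab,
    integral_Ioc_eq_integral_Ioo, integral_Ioc_eq_integral_Ioo]
  exact setIntegral_congr_fun measurableSet_Ioo h

lemma ii_integrable {a b : ℝ} (hab : a ≤ b) {f g : ℝ → ℂ} (h : ∀ x ∈ Set.Ioo a b, f x = g x)
    (hg : Continuous g) : IntervalIntegrable f volume a b := by
  rw [intervalIntegrable_iff_integrableOn_Ioo_of_le hab]
  refine IntegrableOn.congr_fun ?_ (fun x hx => (h x hx).symm) measurableSet_Ioo
  rw [← intervalIntegrable_iff_integrableOn_Ioo_of_le hab]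
  exact hg.intervalIntegrable _ _

lemma exp_pi (ξ : ℤ) : Complex.exp (Complex.I * Real.pi * ξ) = (-1 : ℂ) ^ ξ := by
  rw [mul_comm, ← mul_comm (Real.pi : ℂ), Complex.exp_int_mul, Complex.exp_pi_mul_I]

lemma fCoeff_h (ξ : ℤ) : fCoeff (toC hFun) ξ = -Complex.I * (H ξ : ℂ) := by
  have hp := Real.pi_pos
  have e1 : ∀ x ∈ Set.Ioo (-Real.pi) 0,
      Complex.exp (-Complex.I * x * ξ) * toC hFun x
        = (-1 / 2 : ℂ) * Complex.exp ((-Complex.I * ξ) * x) := by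
    intro x hx
    rw [toC, hFun_neg hx, mul_comm]; push_cast; congr 2; ring
  have e2 : ∀ x ∈ Set.Ioo 0 Real.pi,
      Complex.exp (-Complex.I * x * ξ) * toC hFun x
        = (1 / 2 : ℂ) * Complex.exp ((-Complex.I * ξ) * x) := by
    intro x hx
    rw [toC, hFun_pos hx, mul_comm]; push_cast; congr 2; ring
  have c1 : Continuous fun x : ℝ => (-1 / 2 : ℂ) * Complex.exp ((-Complex.I * ξ) * x) := by
    fun_prop
  have c2 : Continuous fun x : ℝ => (1 / 2 : ℂ) * Complex.exp ((-Complex.I * ξ) * x) := by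
    fun_prop
  unfold fCoeff
  rw [← intervalIntegral.integral_add_adjacent_intervals
    (ii_integrable (by linarith) e1 c1) (ii_integrable hp.le e2 c2),
    ii_congr (by linarith) e1, ii_congr hp.le e2, intervalIntegral.integral_const_mul,
    intervalIntegral.integral_const_mul]
  by_cases h0 : ξ = 0
  · subst h0; simp [H]; ring
  · have hξ : (ξ : ℂ) ≠ 0 := by exact_mod_cast h0
    have hc : (-Complex.I * ξ : ℂ) ≠ 0 := by simp [h0]
    rw [integral_exp_mul_complex hc, integral_exp_mul_complex hc]
    have a1 : Complex.exp (-Complex.I * ξ * ((-Real.pi : ℝ) : ℂ)) = (-1 : ℂ) ^ ξ := by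
      rw [← exp_pi]; congr 1; push_cast; ring
    have a2 : Complex.exp (-Complex.I * ξ * (Real.pi : ℂ)) = (-1 : ℂ) ^ ξ := by
      have : (-Complex.I * ξ * (Real.pi : ℂ)) = Complex.I * Real.pi * ((-ξ : ℤ) : ℂ) := by
        push_cast; ring
      rw [this, exp_pi, zpow_neg, ← inv_zpow]; norm_num
    rw [a1, a2]
    simp only [H, Complex.ofReal_zero, mul_zero, Complex.exp_zero]
    push_cast
    field_simp
    rw [Complex.I_sq]; ring

lemma orth (k : ℤ) : ∫ x in (-Real.pi)..Real.pi, Complex.exp (Complex.I * x * k)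
    = if k = 0 then (2 * Real.pi : ℂ) else 0 := by
  split_ifs with h
  · subst h; simp; ring
  · have hc : (Complex.I * k : ℂ) ≠ 0 := by simp [h]
    have : ∀ x : ℝ, Complex.exp (Complex.I * x * k) = Complex.exp ((Complex.I * k) * x) := by
      intro x; congr 1; ring
    simp_rw [this]
    rw [integral_exp_mul_complex hc]
    have a1 : Complex.exp (Complex.I * k * ((-Real.pi : ℝ) : ℂ)) = (-1 : ℂ) ^ k := by
      have : (Complex.I * k * ((-Real.pi : ℝ) : ℂ)) = Complex.I * Real.pi * ((-k : ℤ) : ℂ) := by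
        push_cast; ring
      rw [this, exp_pi, zpow_neg, ← inv_zpow]; norm_num
    have a2 : Complex.exp (Complex.I * k * (Real.pi : ℂ)) = (-1 : ℂ) ^ k := by
      rw [← exp_pi]; congr 1; ring
    rw [a1, a2]; simp

lemma chi_zero (c : LPCutoff) {x : ℝ} (h : 4 / 3 ≤ |x|) : c.χ x = 0 := by
  by_contra hne
  have := c.supp x hne
  have := abs_lt.2 this
  linarith

lemma phi_zero (c : LPCutoff) {x : ℝ} (h : 8 / 3 ≤ |x|) : c.phi x = 0 := by
  rw [LPCutoff.phi, chi_zero c (x := x) (by linarith), chi_zero c, sub_zero]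
  rw [abs_div, abs_two]; linarith

lemma phi_zero' (c : LPCutoff) {x : ℝ} (h : |x| ≤ 3 / 4) : c.phi x = 0 := by
  have h' := abs_le.1 h
  rw [LPCutoff.phi, c.eq_one x h', c.eq_one (x / 2), sub_self]
  constructor <;> linarith [h'.1, h'.2]

lemma phi_nonneg (c : LPCutoff) (x : ℝ) : 0 ≤ c.phi x := by
  have key : ∀ y : ℝ, 0 ≤ y → c.χ y ≤ c.χ (y / 2) := fun y hy =>
    c.decay (show (0:ℝ) ≤ y / 2 by positivity) hy (by linarith)
  rw [LPCutoff.phi, sub_nonneg]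
  rcases le_total 0 x with h | h
  · exact key x h
  · have := key (-x) (by linarith)
    rwa [neg_div, c.even, c.even] at this

lemma phi_le_one (c : LPCutoff) (x : ℝ) : c.phi x ≤ 1 := by
  have := c.le_one (x / 2); have := c.nonneg x
  rw [LPCutoff.phi]; linarith

lemma phi_one (c : LPCutoff) {x : ℝ} (h1 : 4 / 3 ≤ x) (h2 : x ≤ 3 / 2) : c.phi x = 1 := by
  rw [LPCutoff.phi, chi_zero c (h1.trans (le_abs_self x)), c.eq_one, sub_zero]
  constructor <;> linarith

lemma H_neg (ξ : ℤ) : H (-ξ) = - H ξ := by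
  have : (-1 : ℝ) ^ (-ξ) = (-1) ^ ξ := by rw [zpow_neg, ← inv_zpow]; norm_num
  rw [H, H, this]; push_cast; rw [div_neg]

lemma H_abs (ξ : ℤ) : |H ξ| ≤ 2 / |(ξ : ℝ)| := by
  rw [H, abs_div]
  gcongr
  rcases neg_one_zpow_or ξ with h | h <;> rw [h] <;> norm_num

/-- `2^j` dominates: terms vanish outside the box. -/
lemma box {m : ℕ} {ξ : ℤ} (h : ξ ∉ Finset.Icc (-(3 * 2 ^ m : ℤ)) (3 * 2 ^ m)) :
    3 ≤ |(2:ℝ) ^ (-(m:ℤ)) * ξ| := by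
  have h3 : (3 * 2 ^ m : ℤ) ≤ |ξ| := by
    by_contra hc
    exact h (Finset.mem_Icc.2 (abs_le.1 (not_le.1 hc).le))
  have h3' : (3 * 2 ^ m : ℝ) ≤ |(ξ : ℝ)| := by exact_mod_cast h3
  rw [abs_mul, abs_of_pos (by positivity), zpow_neg, zpow_natCast, inv_mul_eq_div,
    le_div_iff₀ (by positivity)]
  exact h3'

lemma LPlow_real (c : LPCutoff) (j : ℤ) (x : ℝ) :
    (((LPlow c j (toC hFun) x).re : ℝ) : ℂ) = LPlow c j (toC hFun) x := by
  rw [← Complex.conj_eq_iff_re]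
  unfold LPlow
  rw [map_mul, Complex.conj_tsum]
  congr 1
  · simp [Complex.conj_ofNat]
  · rw [← (Equiv.neg ℤ).tsum_eq]
    refine tsum_congr fun ξ => ?_
    simp only [Equiv.neg_apply, fCoeff_h, map_mul, Complex.conj_ofReal, H_neg, Int.cast_neg,
      mul_neg, c.even, ← Complex.exp_conj, map_neg, Complex.conj_I, map_intCast,
      Complex.ofReal_neg, neg_mul, neg_neg]

lemma fCoeff_low (c : LPCutoff) (m : ℕ) (ξ : ℤ) :
    fCoeff (LPlow c m (toC hFun)) ξ
      = (c.χ ((2:ℝ) ^ (-(m:ℤ)) * ξ) : ℂ) * fCoeff (toC hFun) ξ := by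
  set s := Finset.Icc (-(3 * 2 ^ m : ℤ)) (3 * 2 ^ m) with hs
  have hz : ∀ η ∉ s, c.χ ((2:ℝ) ^ (-(m:ℤ)) * η) = 0 := fun η hη =>
    chi_zero c (by linarith [box hη])
  have e : ∀ x : ℝ, Complex.exp (-Complex.I * x * ξ) * LPlow c m (toC hFun) x
      = ∑ η ∈ s, ((1 / (2 * Real.pi)) * ((c.χ ((2:ℝ) ^ (-(m:ℤ)) * η) : ℂ)
          * fCoeff (toC hFun) η)) * Complex.exp (Complex.I * x * ((η - ξ : ℤ) : ℂ)) := by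
    intro x
    rw [LPlow, tsum_eq_sum (s := s), Finset.mul_sum, Finset.mul_sum]
    · refine Finset.sum_congr rfl fun η _ => ?_
      have : Complex.exp (Complex.I * x * ((η - ξ : ℤ) : ℂ))
          = Complex.exp (-Complex.I * x * ξ) * Complex.exp (Complex.I * x * η) := by
        rw [← Complex.exp_add]; congr 1; push_cast; ring
      rw [this]; ring
    · intro η hη
      rw [hz η hη]; simp
  conv_lhs => unfold fCoeff
  simp_rw [e]
  rw [intervalIntegral.integral_finsetSum]
  · simp_rw [intervalIntegral.integral_const_mul, orth, sub_eq_zero]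
    simp only [mul_ite, mul_zero, Finset.sum_ite_eq']
    split_ifs with h
    · have : (Real.pi : ℂ) ≠ 0 := by exact_mod_cast Real.pi_ne_zero
      field_simp
    · rw [hz ξ h]; simp
  · intro η _
    apply Continuous.intervalIntegrable
    fun_prop

lemma part1 (c : LPCutoff) (n : ℕ) (h16 : 16 ∣ n) (hn : 32 ≤ n) (j : ℕ)
    (hj : j ∈ Finset.Icc (n / 8) (n / 4)) :
    LPblock c (j : ℤ) (toC (fLow c n)) = LPblock c (j : ℤ) (toC hFun) := by
  have hf : toC (fLow c n) = LPlow c ((n / 2 : ℕ) : ℤ) (toC hFun) := by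
    funext x
    rw [toC, fLow, LPlow_real]; push_cast; rfl
  rw [hf]
  funext x
  have hj1 : (j : ℤ) ≠ -1 := by omega
  simp only [LPblock, if_neg hj1]
  congr 1
  refine tsum_congr fun ξ => ?_
  congr 1
  rw [fCoeff_low]
  by_cases hb : 8 / 3 ≤ |(2:ℝ) ^ (-(j:ℤ)) * ξ|
  · rw [phi_zero c hb]; simp
  · rw [c.eq_one, Complex.ofReal_one, one_mul]
    rw [Set.mem_Icc, ← abs_le]
    push Not at hb
    rw [abs_mul, abs_of_pos (by positivity), zpow_neg, zpow_natCast, inv_mul_eq_div,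
      div_lt_iff₀ (by positivity)] at hb
    rw [abs_mul, abs_of_pos (by positivity), zpow_neg, zpow_natCast, inv_mul_eq_div,
      div_le_iff₀ (by positivity)]
    have h2 : (2:ℝ) ^ (j + 2) ≤ 2 ^ (n / 2) := by
      apply pow_le_pow_right₀ (by norm_num)
      have := (Finset.mem_Icc.1 hj).2
      omega
    have h3 : (0:ℝ) < 2 ^ (n / 2) := by positivity
    have h4 : (0:ℝ) < 2 ^ j := by positivity
    rw [pow_add] at h2
    linarith

lemma block_sum (c : LPCutoff) (j : ℕ) (x : ℝ) :
    LPblock c (j : ℤ) (toC hFun) x = (1 / (2 * Real.pi)) *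
      ∑ ξ ∈ Finset.Icc (-(3 * 2 ^ j : ℤ)) (3 * 2 ^ j), (c.phi ((2:ℝ) ^ (-(j:ℤ)) * ξ) : ℂ) *
        (-Complex.I * (H ξ : ℂ)) * Complex.exp (Complex.I * x * ξ) := by
  have hj1 : (j : ℤ) ≠ -1 := by omega
  rw [LPblock, if_neg hj1]
  congr 1
  simp_rw [fCoeff_h]
  refine tsum_eq_sum fun ξ hξ => ?_
  rw [phi_zero c (by linarith [box hξ])]; simp

lemma norm_exp (x : ℝ) (ξ : ℤ) : ‖Complex.exp (Complex.I * x * ξ)‖ = 1 := by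
  have : Complex.I * x * ξ = ((x * ξ : ℝ) : ℂ) * Complex.I := by push_cast; ring
  rw [this, Complex.norm_exp_ofReal_mul_I]

lemma upper (c : LPCutoff) (j : ℕ) (x : ℝ) : ‖LPblock c (j : ℤ) (toC hFun) x‖ ≤ 100 := by
  rw [block_sum, norm_mul]
  have hp := Real.pi_gt_three
  have h1 : ‖(1 / (2 * Real.pi) : ℂ)‖ ≤ 1 := by
    have : (1 / (2 * Real.pi) : ℂ) = ((1 / (2 * Real.pi) : ℝ) : ℂ) := by push_cast; rfl
    rw [this, Complex.norm_real, Real.norm_eq_abs, abs_of_pos (by positivity),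
      div_le_one (by positivity)]
    linarith
  have h4 : (1:ℝ) ≤ 2 ^ j := one_le_pow₀ (by norm_num)
  have h2 : ∀ ξ : ℤ, ‖(c.phi ((2:ℝ) ^ (-(j:ℤ)) * ξ) : ℂ) *
        (-Complex.I * (H ξ : ℂ)) * Complex.exp (Complex.I * x * ξ)‖ ≤ 8 / 3 / 2 ^ j := by
    intro ξ
    rw [norm_mul, norm_exp, mul_one, norm_mul, norm_mul, norm_neg, Complex.norm_I, one_mul,
      Complex.norm_real, Complex.norm_real, Real.norm_eq_abs, Real.norm_eq_abs,
      abs_of_nonneg (phi_nonneg c _)]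
    by_cases hb : |(2:ℝ) ^ (-(j:ℤ)) * ξ| ≤ 3 / 4
    · rw [phi_zero' c hb, zero_mul]; positivity
    · push Not at hb
      rw [abs_mul, abs_of_pos (by positivity), zpow_neg, zpow_natCast, inv_mul_eq_div,
        lt_div_iff₀ (by positivity)] at hb
      calc _ ≤ 1 * |H ξ| := by gcongr; exact phi_le_one c _
        _ ≤ 2 / |(ξ : ℝ)| := by rw [one_mul]; exact H_abs ξ
        _ ≤ 2 / (3 / 4 * 2 ^ j) := by gcongr
        _ = _ := by field_simp; norm_num
  calc _ ≤ 1 * ∑ ξ ∈ Finset.Icc (-(3 * 2 ^ j : ℤ)) (3 * 2 ^ j), (8 / 3 / 2 ^ j : ℝ) := by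
        refine mul_le_mul h1 (norm_sum_le_of_le _ fun ξ _ => h2 ξ) (norm_nonneg _) zero_le_one
    _ = (6 * 2 ^ j + 1) * (8 / 3 / 2 ^ j) := by
        rw [one_mul, Finset.sum_const, Int.card_Icc, nsmul_eq_mul]
        congr 1
        have : ((3 * 2 ^ j + 1 - -(3 * 2 ^ j) : ℤ)).toNat = 6 * 2 ^ j + 1 := by
          have : (3 * 2 ^ j + 1 - -(3 * 2 ^ j) : ℤ) = ((6 * 2 ^ j + 1 : ℕ) : ℤ) := by
            push_cast; ring
          rw [this, Int.toNat_natCast]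
        rw [this]; push_cast; rfl
    _ ≤ 100 := by
        rw [← mul_div_assoc, div_le_iff₀ (by positivity)]
        linarith

lemma lower (c : LPCutoff) (j : ℕ) (hj : 4 ≤ j) :
    (1 / 200 : ℝ) ≤ ‖LPblock c (j : ℤ) (toC hFun) ((2:ℝ) ^ (-(j:ℤ)))‖ := by
  refine le_trans ?_ (Complex.re_le_norm _)
  have hp := Real.pi_gt_three
  have hp4 := Real.pi_le_four
  obtain ⟨i, rfl⟩ := Nat.exists_eq_add_of_le hj
  set M : ℕ := 2 ^ i with hM
  have hMpos : (0:ℝ) < M := by positivity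
  have hM2 : (2:ℝ) ^ (4 + i) = 16 * M := by rw [hM, pow_add]; push_cast; norm_num
  set x : ℝ := (2:ℝ) ^ (-((4 + i : ℕ):ℤ)) with hx
  have hxM : x = 1 / (16 * M) := by rw [hx, zpow_neg, zpow_natCast, hM2, one_div]
  have hxpos : 0 < x := by positivity
  rw [block_sum]
  have hc : (1 / (2 * Real.pi) : ℂ) = ((1 / (2 * Real.pi) : ℝ) : ℂ) := by push_cast; rfl
  rw [hc, Complex.re_ofReal_mul, Complex.re_sum]
  have hterm : ∀ ξ : ℤ, ((c.phi (x * ξ) : ℂ) *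
        (-Complex.I * (H ξ : ℂ)) * Complex.exp (Complex.I * x * ξ)).re
        = c.phi (x * ξ) * (H ξ * Real.sin (x * ξ)) := by
    intro ξ
    have : Complex.I * x * ξ = ((x * ξ : ℝ) : ℂ) * Complex.I := by push_cast; ring
    rw [this, Complex.exp_mul_I]
    generalize x * (ξ : ℝ) = y
    rw [← Complex.sin_ofReal_re y]
    simp
    ring
  rw [← hx]
  simp_rw [hterm]
  have hnn : ∀ ξ : ℤ, 0 ≤ c.phi (x * ξ) * (H ξ * Real.sin (x * ξ)) := by
    have key : ∀ ξ : ℤ, 0 < ξ → x * ξ ≤ 3 → 0 ≤ H ξ * Real.sin (x * ξ) := by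
      intro ξ h0 h3
      have h0' : (0:ℝ) < ξ := by exact_mod_cast h0
      refine mul_nonneg ?_ (Real.sin_nonneg_of_nonneg_of_le_pi (by positivity) (by linarith))
      rw [H]
      refine div_nonneg ?_ h0'.le
      rcases neg_one_zpow_or ξ with h | h <;> rw [h] <;> norm_num
    intro ξ
    by_cases hb : 8 / 3 ≤ |x * ξ|
    · rw [phi_zero c hb, zero_mul]
    · push Not at hb
      refine mul_nonneg (phi_nonneg c _) ?_
      have hb' := abs_lt.1 hb
      rcases lt_trichotomy ξ 0 with h | h | h
      · have := key (-ξ) (by omega) (by push_cast; linarith)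
        rw [H_neg] at this
        push_cast at this
        rwa [mul_neg, Real.sin_neg, neg_mul_neg] at this
      · subst h; simp
      · exact key ξ h (by linarith)
  set t : Finset ℤ := (Finset.Ico (11 * M) (12 * M)).image (fun m : ℕ => (2 * m + 1 : ℤ)) with ht
  have hsub : t ⊆ Finset.Icc (-(3 * 2 ^ (4 + i) : ℤ)) (3 * 2 ^ (4 + i)) := by
    intro ξ hξ
    obtain ⟨m, hm, rfl⟩ := Finset.mem_image.1 hξ
    have hm := Finset.mem_Ico.1 hm
    have : (2:ℤ) ^ (4 + i) = 16 * M := by rw [hM, pow_add]; push_cast; norm_num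
    rw [this, Finset.mem_Icc]
    constructor <;> omega
  have hcard : t.card = M := by
    rw [ht, Finset.card_image_of_injective, Nat.card_Ico]
    · omega
    · intro a b hab; simp only at hab; omega
  have hlow : ∀ ξ ∈ t, 1 / (24 * M) ≤ c.phi (x * ξ) * (H ξ * Real.sin (x * ξ)) := by
    intro ξ hξ
    obtain ⟨m, hm, rfl⟩ := Finset.mem_image.1 hξ
    have hm := Finset.mem_Ico.1 hm
    have m1 : (11 * M : ℝ) ≤ m := by exact_mod_cast hm.1
    have m2 : (m + 1 : ℝ) ≤ 12 * M := by exact_mod_cast hm.2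
    have hH : H (2 * m + 1) = 2 / (2 * m + 1 : ℝ) := by
      rw [H, Odd.neg_one_zpow ⟨_, rfl⟩]; push_cast; norm_num
    rw [hH]
    have hcast : (((2 * m + 1 : ℤ)) : ℝ) = 2 * m + 1 := by push_cast; rfl
    rw [hcast]
    have l1 : 4 / 3 ≤ x * (2 * m + 1) := by
      rw [hxM, one_div_mul_eq_div, le_div_iff₀ (by positivity)]; linarith
    have l2 : x * (2 * m + 1) ≤ 3 / 2 := by
      rw [hxM, one_div_mul_eq_div, div_le_iff₀ (by positivity)]; linarith
    rw [phi_one c l1 l2, one_mul]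
    have hs : 1 / 2 ≤ Real.sin (x * (2 * m + 1)) := by
      refine le_trans ?_ (Real.mul_le_sin (by linarith) (by linarith))
      have : 1 / 2 ≤ 2 / Real.pi := by
        rw [div_le_div_iff₀ (by norm_num) (by positivity)]; linarith
      nlinarith
    calc (1 / (24 * M) : ℝ) = 2 / (24 * M) * (1 / 2) := by field_simp
      _ ≤ _ := by gcongr; linarith
  have hsum : (1 / 24 : ℝ) ≤ ∑ ξ ∈ Finset.Icc (-(3 * 2 ^ (4 + i) : ℤ)) (3 * 2 ^ (4 + i)),
      c.phi (x * ξ) * (H ξ * Real.sin (x * ξ)) := by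
    calc (1 / 24 : ℝ) = ∑ ξ ∈ t, 1 / (24 * (M:ℝ)) := by
          rw [Finset.sum_const, hcard, nsmul_eq_mul]; field_simp
      _ ≤ ∑ ξ ∈ t, c.phi (x * ξ) * (H ξ * Real.sin (x * ξ)) := Finset.sum_le_sum hlow
      _ ≤ _ := Finset.sum_le_sum_of_subset_of_nonneg hsub fun ξ _ _ => hnn ξ
  have hpi : (1 / 8 : ℝ) ≤ 1 / (2 * Real.pi) := by
    rw [div_le_div_iff₀ (by norm_num) (by positivity)]; linarith
  calc (1 / 200 : ℝ) ≤ 1 / 8 * (1 / 24) := by norm_num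
    _ ≤ _ := by gcongr

/-- For `n ∈ 16ℕ`, `n ≥ 32`, the blocks of `f_n = S_{n/2}h` with `j ∈ ℕ(n)` agree with those
of `h`; moreover `Σ_{j ∈ ℕ(n)} ‖Δ_j f_n‖_{L^∞} ≈ n` for all sufficiently large `n ∈ 16ℕ`. -/
theorem blocks_fLow (c : LPCutoff) :
    (∀ n : ℕ, 16 ∣ n → 32 ≤ n → ∀ j ∈ Finset.Icc (n / 8) (n / 4),
      LPblock c (j : ℤ) (toC (fLow c n)) = LPblock c (j : ℤ) (toC hFun)) ∧
    ∃ c₀ C : ℝ, 0 < c₀ ∧ 0 < C ∧ ∃ N : ℕ, ∀ n : ℕ, 16 ∣ n → N ≤ n →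
      ENNReal.ofReal (c₀ * n) ≤
          ∑ j ∈ Finset.Icc (n / 8) (n / 4), supNormE (LPblock c (j : ℤ) (toC (fLow c n))) ∧
      ∑ j ∈ Finset.Icc (n / 8) (n / 4), supNormE (LPblock c (j : ℤ) (toC (fLow c n))) ≤
          ENNReal.ofReal (C * n) := by
  refine ⟨fun n h16 hn j hj => part1 c n h16 hn j hj, 1 / 1600, 100, by norm_num, by norm_num, 32, ?_⟩
  intro n h16 hn
  obtain ⟨k, rfl⟩ := h16
  have hcard : (Finset.Icc (16 * k / 8) (16 * k / 4)).card = 2 * k + 1 := by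
    rw [Nat.card_Icc]; omega
  have hk : (2 : ℝ) ≤ k := by
    have : 2 ≤ k := by omega
    exact_mod_cast this
  have hcst : ∀ a : ℝ, 0 ≤ a → ∑ j ∈ Finset.Icc (16 * k / 8) (16 * k / 4), ENNReal.ofReal a
      = ENNReal.ofReal ((2 * k + 1) * a) := by
    intro a ha
    rw [Finset.sum_const, hcard, ← ENNReal.ofReal_nsmul, nsmul_eq_mul]
    push_cast; rfl
  constructor
  · calc ENNReal.ofReal (1 / 1600 * ((16 * k : ℕ) : ℝ))
          ≤ ENNReal.ofReal ((2 * k + 1) * (1 / 200)) := by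
          apply ENNReal.ofReal_le_ofReal; push_cast; linarith
      _ = ∑ j ∈ Finset.Icc (16 * k / 8) (16 * k / 4), ENNReal.ofReal (1 / 200) :=
          (hcst _ (by norm_num)).symm
      _ ≤ _ := by
          refine Finset.sum_le_sum fun j hj => ?_
          rw [part1 c _ ⟨k, rfl⟩ hn j hj]
          have hj4 : 4 ≤ j := by have := (Finset.mem_Icc.1 hj).1; omega
          refine le_trans ?_ (le_iSup _ ((2:ℝ) ^ (-(j:ℤ))))
          rw [← enorm_eq_nnnorm, ← ofReal_norm]
          exact ENNReal.ofReal_le_ofReal (lower c j hj4)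
  · calc _ ≤ ∑ j ∈ Finset.Icc (16 * k / 8) (16 * k / 4), ENNReal.ofReal 100 := by
          refine Finset.sum_le_sum fun j hj => ?_
          rw [part1 c _ ⟨k, rfl⟩ hn j hj]
          refine iSup_le fun x => ?_
          rw [← enorm_eq_nnnorm, ← ofReal_norm]
          exact ENNReal.ofReal_le_ofReal (upper c j x)
      _ = ENNReal.ofReal ((2 * k + 1) * 100) := hcst _ (by norm_num)
      _ ≤ _ := by
          apply ENNReal.ofReal_le_ofReal; push_cast; linarith
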